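/- For all admissible r, if k ∈ J³_F(r), then k + (s−1)(r+1) ∈ J³_F(2r+1) for every s ∈ {1, 2, …, 2r−2} ∪ {2r+1}. -/

import Mathlib

/-- A Steiner triple system of order `v`: a collection of 3-element subsets of a
`v`-point set such that every 2-element subset lies in exactly one triple. -/
def IsSTS (v : ℕ) (B : Finset (Finset (Fin v))) : Prop :=
  (∀ b ∈ B, b.card = 3) ∧
  ∀ p : Finset (Fin v), p.card = 2 → ∃! b, b ∈ B ∧ p ⊆ b

/-- The flower at a point `x`: the set of all triples containing `x`. -/
def flowerAt {v : ℕ} (B : Finset (Finset (Fin v))) (x : Fin v) : Finset (Finset (Fin v)) :=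
  B.filter fun b => x ∈ b

/-- `J3F r`: the set of all `k` for which there exist three `STS(2r+1)`'s on a common
point set such that each pair of them intersects in the same set of `k + r` triples,
`r` of which form the flower at a common point. -/
def J3F (r : ℕ) : Set ℕ :=
  {k | ∃ (B₁ B₂ B₃ : Finset (Finset (Fin (2 * r + 1)))) (x : Fin (2 * r + 1)),
    IsSTS (2 * r + 1) B₁ ∧ IsSTS (2 * r + 1) B₂ ∧ IsSTS (2 * r + 1) B₃ ∧
    B₁ ∩ B₂ = B₁ ∩ B₃ ∧ B₁ ∩ B₂ = B₂ ∩ B₃ ∧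
    (B₁ ∩ B₂).card = k + r ∧
    flowerAt B₁ x = flowerAt B₂ x ∧ flowerAt B₁ x = flowerAt B₃ x ∧
    (flowerAt B₁ x).card = r}

/-- `J3 v`: the set of all `k` for which there exist three `STS(v)`'s on a common point
set pairwise intersecting in the same set of `k` triples. -/
def J3 (v : ℕ) : Set ℕ :=
  {k | ∃ (B₁ B₂ B₃ : Finset (Finset (Fin v))),
    IsSTS v B₁ ∧ IsSTS v B₂ ∧ IsSTS v B₃ ∧
    B₁ ∩ B₂ = B₁ ∩ B₃ ∧ B₁ ∩ B₂ = B₂ ∩ B₃ ∧ (B₁ ∩ B₂).card = k}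

/-- `JF r`: the set of all `k` for which there exist two `STS(2r+1)`'s on a common
point set having exactly `k + r` triples in common, `r` of them forming a common flower. -/
def JF (r : ℕ) : Set ℕ :=
  {k | ∃ (B₁ B₂ : Finset (Finset (Fin (2 * r + 1)))) (x : Fin (2 * r + 1)),
    IsSTS (2 * r + 1) B₁ ∧ IsSTS (2 * r + 1) B₂ ∧
    (B₁ ∩ B₂).card = k + r ∧
    flowerAt B₁ x = flowerAt B₂ x ∧ (flowerAt B₁ x).card = r}

/-- `S3 m`: the nonnegative integers at most `m`, with the exception of
`m-1, m-2, m-3, m-4, m-5, m-7`. -/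
def S3 (m : ℕ) : Set ℕ :=
  {k | k ≤ m ∧ k + 1 ≠ m ∧ k + 2 ≠ m ∧ k + 3 ≠ m ∧ k + 4 ≠ m ∧ k + 5 ≠ m ∧ k + 7 ≠ m}

/-- `I3F r = S3 (2r(r-1)/3)`. -/
def I3F (r : ℕ) : Set ℕ := S3 (2 * r * (r - 1) / 3)

/-- A Latin square of order `n` as a function: each row and each column is injective
(hence a permutation of the `n` symbols). -/
def IsLatin (n : ℕ) (L : Fin n → Fin n → Fin n) : Prop :=
  (∀ i, Function.Injective (L i)) ∧ (∀ j, Function.Injective fun i => L i j)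

/-- The cells where three squares all have identical entries. -/
def agreeCells (n : ℕ) (L₁ L₂ L₃ : Fin n → Fin n → Fin n) : Finset (Fin n × Fin n) :=
  Finset.univ.filter fun p => L₁ p.1 p.2 = L₂ p.1 p.2 ∧ L₂ p.1 p.2 = L₃ p.1 p.2

/-- `J3L n` (written `J'³(n)`): the set of `k` for which there exist three Latin squares
of order `n` with exactly `k` cells where all three have identical entries and all other
cells containing pairwise distinct entries in the three squares. -/
def J3L (n : ℕ) : Set ℕ :=
  {k | ∃ L₁ L₂ L₃ : Fin n → Fin n → Fin n,
    IsLatin n L₁ ∧ IsLatin n L₂ ∧ IsLatin n L₃ ∧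
    (agreeCells n L₁ L₂ L₃).card = k ∧
    ∀ p : Fin n × Fin n, p ∉ agreeCells n L₁ L₂ L₃ →
      L₁ p.1 p.2 ≠ L₂ p.1 p.2 ∧ L₁ p.1 p.2 ≠ L₃ p.1 p.2 ∧ L₂ p.1 p.2 ≠ L₃ p.1 p.2}

/-- `J3LD n` (written `J''³(n)`): as `J3L n`, but additionally the three Latin squares
share the same constant value on the secondary diagonal (cells `(i, n-1-i)`). -/
def J3LD (n : ℕ) : Set ℕ :=
  {k | ∃ L₁ L₂ L₃ : Fin n → Fin n → Fin n,
    IsLatin n L₁ ∧ IsLatin n L₂ ∧ IsLatin n L₃ ∧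
    (∃ c, ∀ i : Fin n, L₁ i i.rev = c ∧ L₂ i i.rev = c ∧ L₃ i i.rev = c) ∧
    (agreeCells n L₁ L₂ L₃).card = k ∧
    ∀ p : Fin n × Fin n, p ∉ agreeCells n L₁ L₂ L₃ →
      L₁ p.1 p.2 ≠ L₂ p.1 p.2 ∧ L₁ p.1 p.2 ≠ L₃ p.1 p.2 ∧ L₂ p.1 p.2 ≠ L₃ p.1 p.2}

/-- A pairwise balanced design `B(K, 1, v)`: blocks have sizes in `K` and every
2-element subset of the `v`-point set lies in exactly one block. -/
def IsPBD (v : ℕ) (K : Set ℕ) (A : Finset (Finset (Fin v))) : Prop :=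
  (∀ b ∈ A, b.card ∈ K) ∧
  ∀ p : Finset (Fin v), p.card = 2 → ∃! b, b ∈ A ∧ p ⊆ b

open Finset

section Doubling

/-- A Steiner triple system on a finite type, stated in terms of pairs of distinct points. -/
def IsSteiner {α : Type*} (B : Finset (Finset α)) : Prop :=
  (∀ b ∈ B, b.card = 3) ∧ ∀ u v : α, u ≠ v → ∃! b, b ∈ B ∧ u ∈ b ∧ v ∈ b

theorem isSTS_iff_isSteiner {n : ℕ} {B : Finset (Finset (Fin n))} :
    IsSTS n B ↔ IsSteiner B := by
  refine and_congr_right fun _ => ⟨fun h u v huv => ?_, fun h p hp => ?_⟩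
  · simpa [insert_subset_iff] using h {u, v} (card_pair huv)
  · obtain ⟨u, v, huv, rfl⟩ := card_eq_two.mp hp
    simpa [insert_subset_iff] using h u v huv

theorem IsSteiner.map {α β : Type*} {B : Finset (Finset α)} (h : IsSteiner B) (e : α ≃ β) :
    IsSteiner (B.map e.finsetCongr.toEmbedding) := by
  constructor
  · intro b hb
    obtain ⟨t, ht, rfl⟩ := mem_map.mp hb
    simpa using h.1 t ht
  · intro u v huv
    obtain ⟨t, ⟨ht, hu, hv⟩, huniq⟩ := h.2 (e.symm u) (e.symm v) (by simpa using huv)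
    refine ⟨t.map e.toEmbedding, ⟨mem_map.mpr ⟨t, ht, rfl⟩, ?_, ?_⟩, ?_⟩
    · simpa [mem_map_equiv] using hu
    · simpa [mem_map_equiv] using hv
    · rintro b ⟨hb, hub, hvb⟩
      obtain ⟨t', ht', rfl⟩ := mem_map.mp hb
      rw [huniq t' ⟨ht', by simpa [mem_map_equiv] using hub, by simpa [mem_map_equiv] using hvb⟩]
      rfl

/-- Membership in `J3F` can be witnessed on any point set of the right size. -/
theorem mem_J3F_of_isSteiner {α : Type*} [Fintype α] [DecidableEq α] {r k : ℕ}
    (hcard : Fintype.card α = 2 * r + 1) {B₁ B₂ B₃ : Finset (Finset α)} {x : α}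
    (h₁ : IsSteiner B₁) (h₂ : IsSteiner B₂) (h₃ : IsSteiner B₃)
    (h₁₃ : B₁ ∩ B₂ = B₁ ∩ B₃) (h₂₃ : B₁ ∩ B₂ = B₂ ∩ B₃) (hk : (B₁ ∩ B₂).card = k + r)
    (hx₂ : {b ∈ B₁ | x ∈ b} = {b ∈ B₂ | x ∈ b}) (hx₃ : {b ∈ B₁ | x ∈ b} = {b ∈ B₃ | x ∈ b})
    (hx : #{b ∈ B₁ | x ∈ b} = r) : k ∈ J3F r := by
  let e : α ≃ Fin (2 * r + 1) := Fintype.equivFinOfCardEq hcard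
  have hflower (B : Finset (Finset α)) :
      flowerAt (B.map e.finsetCongr.toEmbedding) (e x) =
        {b ∈ B | x ∈ b}.map e.finsetCongr.toEmbedding := by
    simp [flowerAt, filter_map, Function.comp_def]
  refine ⟨B₁.map e.finsetCongr.toEmbedding, B₂.map e.finsetCongr.toEmbedding,
    B₃.map e.finsetCongr.toEmbedding, e x, isSTS_iff_isSteiner.mpr (h₁.map e),
    isSTS_iff_isSteiner.mpr (h₂.map e), isSTS_iff_isSteiner.mpr (h₃.map e), ?_, ?_, ?_, ?_, ?_, ?_⟩
  · rw [← map_inter, ← map_inter, h₁₃]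
  · rw [← map_inter, ← map_inter, h₂₃]
  · rw [← map_inter, card_map, hk]
  · rw [hflower, hflower, hx₂]
  · rw [hflower, hflower, hx₃]
  · rw [hflower, card_map, hx]

/-- A one-factorization of the complete graph on `Y`, with factors indexed by `X`: in the factor
indexed by `x`, the point `y` is matched with `P x y`. -/
structure IsOneFactorization {X Y : Type*} (P : X → Y → Y) : Prop where
  involutive : ∀ x, Function.Involutive (P x)
  ne_self : ∀ x y, P x y ≠ y
  existsUnique : ∀ y y', y ≠ y' → ∃! x, P x y = y'

theorem IsOneFactorization.comp_perm {X Y : Type*} {P : X → Y → Y} (h : IsOneFactorization P)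
    (π : Equiv.Perm X) : IsOneFactorization (P ∘ π) where
  involutive x := h.involutive (π x)
  ne_self x := h.ne_self (π x)
  existsUnique y y' hy := (π.existsUnique_congr fun {_} => Iff.rfl).mpr (h.existsUnique y y' hy)

/-- The partner function of the standard one-factorization of the complete graph on
`ZMod (2 * r + 1)` together with a point at infinity. -/
def cyclicPartner (r : ℕ) (x : ZMod (2 * r + 1)) :
    Option (ZMod (2 * r + 1)) → Option (ZMod (2 * r + 1))
  | none => some ((r + 1) * x)
  | some a => if a + a = x then none else some (x - a)

theorem isOneFactorization_cyclicPartner (r : ℕ) : IsOneFactorization (cyclicPartner r) := by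
  have h2 : (2 * r + 1 : ZMod (2 * r + 1)) = 0 := by
    exact_mod_cast ZMod.natCast_self (2 * r + 1)
  have hhalf (x : ZMod (2 * r + 1)) : (r + 1) * x + (r + 1) * x = x := by
    linear_combination x * h2
  have hdouble {a x : ZMod (2 * r + 1)} (h : a + a = x) : (r + 1) * x = a := by
    linear_combination a * h2 - (r + 1) * h
  refine ⟨?_, ?_, ?_⟩
  · rintro x (_ | a)
    · simp [cyclicPartner, hhalf]
    · by_cases h : a + a = x
      · simp [cyclicPartner, h, hdouble h]
      · have h' : ¬ (x - a) + (x - a) = x := fun h' => h (by linear_combination -h')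
        simp [cyclicPartner, h, h']
  · rintro x (_ | a)
    · simp [cyclicPartner]
    · by_cases h : a + a = x
      · simp [cyclicPartner, h]
      · simp only [cyclicPartner, if_neg h, ne_eq, Option.some.injEq]
        exact fun h' => h (by linear_combination -h')
  · rintro (_ | a) (_ | b) hab
    · exact absurd rfl hab
    · refine ⟨b + b, by simp [cyclicPartner, hdouble rfl], fun x hx => ?_⟩
      simp only [cyclicPartner, Option.some.injEq] at hx
      rw [← hx, hhalf]
    · refine ⟨a + a, by simp [cyclicPartner], fun x hx => ?_⟩
      by_contra h
      simp [cyclicPartner, Ne.symm h] at hx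
    · have hab' : b ≠ a := fun h => hab (by rw [h])
      refine ⟨a + b, by simp [cyclicPartner, hab'.symm], fun x hx => ?_⟩
      by_cases h : a + a = x
      · simp [cyclicPartner, h] at hx
      · simp only [cyclicPartner, if_neg h, Option.some.injEq] at hx
        linear_combination hx

variable {X Y : Type*}

/-- The triples of a system on `X`, viewed in `X ⊕ Y`. -/
def liftTriples (Y : Type*) (B : Finset (Finset X)) : Finset (Finset (X ⊕ Y)) :=
  B.map (mapEmbedding Function.Embedding.inl).toEmbedding

theorem mem_liftTriples {B : Finset (Finset X)} {t : Finset (X ⊕ Y)} :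
    t ∈ liftTriples Y B ↔ ∃ b ∈ B, b.map Function.Embedding.inl = t := by
  simp [liftTriples]

variable [DecidableEq X] [DecidableEq Y]

/-- The triple joining `x` to the edge at `y` of the factor indexed by `x`. -/
def mixedTriple (P : X → Y → Y) (x : X) (y : Y) : Finset (X ⊕ Y) :=
  {Sum.inl x, Sum.inr y, Sum.inr (P x y)}

/-- The triples joining `x` to the edges of the factor indexed by `x`. -/
def mixedTriples [Fintype Y] (P : X → Y → Y) (x : X) : Finset (Finset (X ⊕ Y)) :=
  univ.image (mixedTriple P x)

/-- The doubling construction. -/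
def doubling [Fintype X] [Fintype Y] (B : Finset (Finset X)) (P : X → Y → Y) :
    Finset (Finset (X ⊕ Y)) :=
  liftTriples Y B ∪ univ.biUnion (mixedTriples P)

theorem mem_mixedTriples [Fintype Y] {P : X → Y → Y} {x : X} {t : Finset (X ⊕ Y)} :
    t ∈ mixedTriples P x ↔ ∃ y, mixedTriple P x y = t := by
  simp [mixedTriples]

theorem mem_doubling [Fintype X] [Fintype Y] {B : Finset (Finset X)} {P : X → Y → Y}
    {t : Finset (X ⊕ Y)} :
    t ∈ doubling B P ↔
      (∃ b ∈ B, b.map Function.Embedding.inl = t) ∨ ∃ x y, mixedTriple P x y = t := by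
  simp [doubling, mem_liftTriples, mem_mixedTriples]

theorem inl_mem_mixedTriple {P : X → Y → Y} {x x' : X} {y : Y} :
    Sum.inl x' ∈ mixedTriple P x y ↔ x' = x := by
  simp [mixedTriple]

theorem inr_mem_mixedTriple {P : X → Y → Y} {x : X} {y y' : Y} :
    Sum.inr y' ∈ mixedTriple P x y ↔ y' = y ∨ y' = P x y := by
  simp [mixedTriple]

theorem map_inl_ne_mixedTriple {P : X → Y → Y} {b : Finset X} {x : X} {y : Y} :
    b.map Function.Embedding.inl ≠ mixedTriple P x y := by
  intro h
  have : Sum.inr y ∈ b.map (Function.Embedding.inl (β := Y)) := by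
    rw [h]; simp [inr_mem_mixedTriple]
  simp at this

theorem IsOneFactorization.mixedTriple_partner {P : X → Y → Y} (h : IsOneFactorization P)
    (x : X) (y : Y) : mixedTriple P x (P x y) = mixedTriple P x y := by
  rw [mixedTriple, mixedTriple, h.involutive x y, pair_comm]

theorem IsOneFactorization.mixedTriple_eq_of_mem {P : X → Y → Y} (h : IsOneFactorization P)
    {x : X} {y y' : Y} (hy : Sum.inr y' ∈ mixedTriple P x y) :
    mixedTriple P x y = mixedTriple P x y' := by
  rcases inr_mem_mixedTriple.mp hy with rfl | rfl
  · rfl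
  · exact (h.mixedTriple_partner x y).symm

theorem IsOneFactorization.isSteiner_doubling [Fintype X] [Fintype Y] {P : X → Y → Y}
    (h : IsOneFactorization P) {B : Finset (Finset X)} (hB : IsSteiner B) :
    IsSteiner (doubling B P) := by
  have hmixed (x : X) (y : Y) :
      ∃! t, t ∈ doubling B P ∧ Sum.inl x ∈ t ∧ Sum.inr y ∈ t := by
    refine ⟨mixedTriple P x y, ⟨mem_doubling.mpr (Or.inr ⟨x, y, rfl⟩),
      inl_mem_mixedTriple.mpr rfl, inr_mem_mixedTriple.mpr (Or.inl rfl)⟩, ?_⟩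
    rintro t ⟨ht, hx, hy⟩
    rcases mem_doubling.mp ht with ⟨b, -, rfl⟩ | ⟨x', y', rfl⟩
    · simp at hy
    · obtain rfl := inl_mem_mixedTriple.mp hx
      exact h.mixedTriple_eq_of_mem hy
  constructor
  · intro t ht
    rcases mem_doubling.mp ht with ⟨b, hb, rfl⟩ | ⟨x, y, rfl⟩
    · rw [card_map, hB.1 b hb]
    · exact card_eq_three.mpr ⟨_, _, _, Sum.inl_ne_inr, Sum.inl_ne_inr,
        fun e => h.ne_self x y (Sum.inr_injective e).symm, rfl⟩
  · rintro (u | u) (v | v) huv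
    · obtain ⟨b, ⟨hb, hu, hv⟩, huniq⟩ := hB.2 u v fun e => huv (e ▸ rfl)
      refine ⟨b.map Function.Embedding.inl,
        ⟨mem_doubling.mpr (Or.inl ⟨b, hb, rfl⟩), by simpa using hu, by simpa using hv⟩, ?_⟩
      rintro t ⟨ht, hu', hv'⟩
      rcases mem_doubling.mp ht with ⟨b', hb', rfl⟩ | ⟨x, y, rfl⟩
      · rw [huniq b' ⟨hb', by simpa using hu', by simpa using hv'⟩]
      · rw [inl_mem_mixedTriple] at hu' hv'
        exact absurd (hu'.trans hv'.symm) fun e => huv (e ▸ rfl)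
    · exact hmixed u v
    · simpa only [and_comm (a := Sum.inr u ∈ _)] using hmixed v u
    · have huv' : u ≠ v := fun e => huv (e ▸ rfl)
      obtain ⟨x, hx, huniq⟩ := h.existsUnique u v huv'
      refine ⟨mixedTriple P x u, ⟨mem_doubling.mpr (Or.inr ⟨x, u, rfl⟩),
        inr_mem_mixedTriple.mpr (Or.inl rfl), inr_mem_mixedTriple.mpr (Or.inr hx.symm)⟩, ?_⟩
      rintro t ⟨ht, hu, hv⟩
      rcases mem_doubling.mp ht with ⟨b, -, rfl⟩ | ⟨x', y, rfl⟩
      · simp at hu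
      · rw [h.mixedTriple_eq_of_mem hu] at hv ⊢
        rcases inr_mem_mixedTriple.mp hv with e | e
        · exact absurd e.symm huv'
        · rw [huniq x' e.symm]

theorem IsOneFactorization.two_mul_card_mixedTriples [Fintype Y] {P : X → Y → Y}
    (h : IsOneFactorization P) (x : X) : 2 * #(mixedTriples P x) = Fintype.card Y := by
  rw [← card_univ, card_eq_sum_card_image (mixedTriple P x), mul_comm, ← smul_eq_mul,
    ← sum_const]
  refine sum_congr rfl fun t ht => ?_
  obtain ⟨y, rfl⟩ := mem_mixedTriples.mp ht
  have : ({y' | mixedTriple P x y' = mixedTriple P x y} : Finset Y) = {y, P x y} := by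
    ext y'
    simp only [mem_filter, mem_univ, true_and, mem_insert, mem_singleton]
    refine ⟨fun e => ?_, ?_⟩
    · rw [← inr_mem_mixedTriple, ← e, inr_mem_mixedTriple]
      exact Or.inl rfl
    · rintro (rfl | rfl)
      · rfl
      · exact h.mixedTriple_partner x y
  rw [this, card_pair (h.ne_self x y).symm]

theorem disjoint_liftTriples_biUnion_mixedTriples [Fintype Y] (P : X → Y → Y)
    (B : Finset (Finset X)) (S : Finset X) :
    Disjoint (liftTriples Y B) (S.biUnion (mixedTriples P)) := by
  refine disjoint_left.mpr fun t ht ht' => ?_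
  obtain ⟨b, -, rfl⟩ := mem_liftTriples.mp ht
  obtain ⟨x, -, hx⟩ := mem_biUnion.mp ht'
  obtain ⟨y, hy⟩ := mem_mixedTriples.mp hx
  exact map_inl_ne_mixedTriple hy.symm

theorem IsOneFactorization.card_liftTriples_union [Fintype Y] {P : X → Y → Y}
    (h : IsOneFactorization P) {n : ℕ} (hn : Fintype.card Y = 2 * n) (B : Finset (Finset X))
    (S : Finset X) : #(liftTriples Y B ∪ S.biUnion (mixedTriples P)) = #B + #S * n := by
  have hcard (x : X) : #(mixedTriples P x) = n := by
    have := h.two_mul_card_mixedTriples x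
    omega
  rw [card_union_of_disjoint (disjoint_liftTriples_biUnion_mixedTriples P B S), card_biUnion,
    sum_congr rfl fun x _ => hcard x, sum_const, smul_eq_mul, liftTriples, card_map]
  intro x _ x' _ hne
  refine disjoint_left.mpr fun t ht ht' => hne ?_
  obtain ⟨y, rfl⟩ := mem_mixedTriples.mp ht
  obtain ⟨y', hy'⟩ := mem_mixedTriples.mp ht'
  rw [← inl_mem_mixedTriple (P := P) (y := y'), hy', inl_mem_mixedTriple]

theorem IsOneFactorization.doubling_inter_doubling [Fintype X] [Fintype Y] {P : X → Y → Y}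
    (h : IsOneFactorization P) (B B' : Finset (Finset X)) {S : Finset X} {π π' : Equiv.Perm X}
    (hfix : ∀ x ∈ S, π x = x) (hS : ∀ x, π x = π' x ↔ x ∈ S) :
    doubling B (P ∘ π) ∩ doubling B' (P ∘ π') =
      liftTriples Y (B ∩ B') ∪ S.biUnion (mixedTriples P) := by
  ext t
  simp only [mem_inter, mem_union, mem_doubling, mem_liftTriples, mem_biUnion, mem_mixedTriples]
  constructor
  · rintro ⟨⟨b, hb, rfl⟩ | ⟨x, y, rfl⟩, ⟨b', hb', e⟩ | ⟨x', y', e⟩⟩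
    · obtain rfl := map_injective _ e
      exact Or.inl ⟨b', ⟨hb, hb'⟩, rfl⟩
    · exact absurd e.symm map_inl_ne_mixedTriple
    · exact absurd e map_inl_ne_mixedTriple
    · obtain rfl : x' = x := by
        rw [← inl_mem_mixedTriple (P := P ∘ π) (y := y), ← e, inl_mem_mixedTriple]
      have hy : Sum.inr y ∈ mixedTriple (P ∘ π') x' y' := by
        rw [e]; exact inr_mem_mixedTriple.mpr (Or.inl rfl)
      have hy' : Sum.inr (P (π x') y) ∈ mixedTriple (P ∘ π') x' y := by
        rw [← (h.comp_perm π').mixedTriple_eq_of_mem hy, e]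
        exact inr_mem_mixedTriple.mpr (Or.inr rfl)
      have hP : P (π x') y = P (π' x') y :=
        (inr_mem_mixedTriple.mp hy').resolve_left (h.ne_self _ _)
      have hx : x' ∈ S := (hS x').mp <|
        (h.existsUnique y _ (h.ne_self (π' x') y).symm).unique hP rfl
      exact Or.inr ⟨x', hx, y, by simp [mixedTriple, hfix x' hx]⟩
  · rintro (⟨b, ⟨hb, hb'⟩, rfl⟩ | ⟨x, hx, y, rfl⟩)
    · exact ⟨Or.inl ⟨b, hb, rfl⟩, Or.inl ⟨b, hb', rfl⟩⟩
    · refine ⟨Or.inr ⟨x, y, ?_⟩, Or.inr ⟨x, y, ?_⟩⟩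
      · simp [mixedTriple, hfix x hx]
      · simp [mixedTriple, ← (hS x).mpr hx, hfix x hx]

theorem filter_inl_mem_doubling [Fintype X] [Fintype Y] (P : X → Y → Y) (B : Finset (Finset X))
    {π : Equiv.Perm X} {x : X} (hx : π x = x) :
    {t ∈ doubling B (P ∘ π) | Sum.inl x ∈ t} =
      liftTriples Y {b ∈ B | x ∈ b} ∪ ({x} : Finset X).biUnion (mixedTriples P) := by
  ext t
  simp only [mem_filter, mem_union, mem_doubling, mem_liftTriples, singleton_biUnion,
    mem_mixedTriples]
  constructor
  · rintro ⟨⟨b, hb, rfl⟩ | ⟨x', y, rfl⟩, ht⟩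
    · exact Or.inl ⟨b, ⟨hb, by simpa using ht⟩, rfl⟩
    · obtain rfl := inl_mem_mixedTriple.mp ht
      exact Or.inr ⟨y, by simp [mixedTriple, hx]⟩
  · rintro (⟨b, ⟨hb, hxb⟩, rfl⟩ | ⟨y, rfl⟩)
    · exact ⟨Or.inl ⟨b, hb, rfl⟩, by simpa using hxb⟩
    · exact ⟨Or.inr ⟨x, y, by simp [mixedTriple, hx]⟩, inl_mem_mixedTriple.mpr rfl⟩

end Doubling

/-- A permutation fixing exactly the points of `S`, whose square also fixes exactly these. -/
theorem exists_perm_fixing_iff_mem {X : Type*} [Fintype X] [DecidableEq X] (S : Finset X)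
    (hS : #Sᶜ = 0 ∨ 3 ≤ #Sᶜ) :
    ∃ σ : Equiv.Perm X, (∀ x, σ x = x ↔ x ∈ S) ∧ ∀ x, σ (σ x) = x ↔ x ∈ S := by
  obtain ⟨σ, hσ, hsupp⟩ := exists_cycleOn Sᶜ
  have hfix {x : X} (hx : x ∈ S) : σ x = x := by
    by_contra hne
    exact mem_compl.mp (hsupp (Equiv.Perm.mem_support.mpr hne)) hx
  have hmove {x : X} (hx : x ∉ S) {n : ℕ} (h0 : n ≠ 0) (hn : n < 3) : (σ ^ n) x ≠ x := by
    have hx' : x ∈ Sᶜ := mem_compl.mpr hx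
    rw [ne_eq, hσ.pow_apply_eq hx']
    intro hdvd
    have := Nat.le_of_dvd (Nat.pos_of_ne_zero h0) hdvd
    have := card_pos.mpr ⟨x, hx'⟩
    omega
  refine ⟨σ, fun x => ⟨fun e => ?_, hfix⟩, fun x => ⟨fun e => ?_, fun hx => ?_⟩⟩
  · by_contra hx
    exact hmove hx one_ne_zero (by norm_num) (by simpa using e)
  · by_contra hx
    exact hmove hx two_ne_zero (by norm_num) (by simpa [pow_two] using e)
  · rw [hfix hx, hfix hx]

/-- For all admissible `r`, if `k ∈ J³_F(r)` then
`k + (s-1)(r+1) ∈ J³_F(2r+1)` for every `s ∈ {1, …, 2r-2} ∪ {2r+1}`. -/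
theorem stmt6 (r : ℕ) (hadm : r % 3 = 0 ∨ r % 3 = 1) (k : ℕ) (hk : k ∈ J3F r)
    (s : ℕ) (hs : (1 ≤ s ∧ s ≤ 2 * r - 2) ∨ s = 2 * r + 1) :
    k + (s - 1) * (r + 1) ∈ J3F (2 * r + 1) := by
  obtain ⟨B₁, B₂, B₃, x, h₁, h₂, h₃, h₁₃, h₂₃, hcard, hx₂, hx₃, hx⟩ := hk
  rw [isSTS_iff_isSteiner] at h₁ h₂ h₃
  obtain ⟨S, hxS, -, hS⟩ := exists_subsuperset_card_eq (subset_univ {x})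
    (show #{x} ≤ s by rw [card_singleton]; omega)
    (show s ≤ #(univ : Finset (Fin (2 * r + 1))) by simp; omega)
  rw [singleton_subset_iff] at hxS
  obtain ⟨σ, hσ, hσ₂⟩ := exists_perm_fixing_iff_mem S (by
    rw [card_compl, hS, Fintype.card_fin]; omega)
  let f : Fin (2 * r + 1) ≃ ZMod (2 * r + 1) := Fintype.equivOfCardEq (by simp [ZMod.card])
  obtain ⟨P, hP⟩ : ∃ P : Fin (2 * r + 1) → Option (ZMod (2 * r + 1)) → _,
      IsOneFactorization P :=
    ⟨cyclicPartner r ∘ f, fun i => (isOneFactorization_cyclicPartner r).involutive (f i),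
      fun i => (isOneFactorization_cyclicPartner r).ne_self (f i), fun y y' hy =>
      (f.existsUnique_congr fun {_} => Iff.rfl).mpr
        ((isOneFactorization_cyclicPartner r).existsUnique y y' hy)⟩
  have hY : Fintype.card (Option (ZMod (2 * r + 1))) = 2 * (r + 1) := by
    rw [Fintype.card_option, ZMod.card]; ring
  have h₁₂' := hP.doubling_inter_doubling B₁ B₂ (S := S) (π := 1) (π' := σ)
    (fun _ _ => rfl) (fun y => by rw [← hσ y, eq_comm]; rfl)
  have h₁₃' := hP.doubling_inter_doubling B₁ B₃ (S := S) (π := 1) (π' := σ * σ)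
    (fun _ _ => rfl) (fun y => by rw [← hσ₂ y, eq_comm]; rfl)
  have h₂₃' := hP.doubling_inter_doubling B₂ B₃ (S := S) (π := σ) (π' := σ * σ)
    (fun y hy => (hσ y).mpr hy)
    (fun y => by rw [← hσ y, Equiv.Perm.mul_apply, σ.injective.eq_iff, eq_comm])
  have hf₁ := filter_inl_mem_doubling P B₁ (π := 1) (x := x) rfl
  have hf₂ := filter_inl_mem_doubling P B₂ (π := σ) ((hσ x).mpr hxS)
  have hf₃ := filter_inl_mem_doubling P B₃ (π := σ * σ) ((hσ₂ x).mpr hxS)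
  unfold flowerAt at hx₂ hx₃ hx
  refine mem_J3F_of_isSteiner ?_ ((hP.comp_perm 1).isSteiner_doubling h₁)
    ((hP.comp_perm σ).isSteiner_doubling h₂) ((hP.comp_perm (σ * σ)).isSteiner_doubling h₃)
    (x := Sum.inl x) ?_ ?_ ?_ ?_ ?_ ?_
  · rw [Fintype.card_sum, hY, Fintype.card_fin]; ring
  · rw [h₁₂', h₁₃', h₁₃]
  · rw [h₁₂', h₂₃', h₂₃]
  · rw [h₁₂', hP.card_liftTriples_union hY, hcard, hS]
    obtain ⟨m, rfl⟩ : ∃ m, s = m + 1 := ⟨s - 1, by omega⟩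
    rw [Nat.add_sub_cancel]
    ring
  · rw [hf₁, hf₂, hx₂]
  · rw [hf₁, hf₃, hx₃]
  · rw [hf₁, hP.card_liftTriples_union hY, hx, card_singleton]
    ring
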